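/- Let (Ω, 𝓕) be a measurable space and let c : 𝓕 → [0,1] be a monotone, normalized, submodular set function. For all bounded measurable X, Y : Ω → ℝ taking values in ℕ, one has ∫(X + Y) dc ≤ ∫(⌊X/2⌋ + ⌊(Y+1)/2⌋) dc + ∫(⌊(X+1)/2⌋ + ⌊Y/2⌋) dc, where the floor functions are applied pointwise. -/

import Mathlib

open MeasureTheory Set

/-- The Choquet integral of `X` with respect to the set function `c`:
`∫ X dc = ∫_{-∞}^0 (c(X > x) - 1) dx + ∫_0^∞ c(X > x) dx`. -/
noncomputable def choquet {Ω : Type*} [MeasurableSpace Ω] (c : Set Ω → ℝ) (X : Ω → ℝ) : ℝ :=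
  (∫ x in Set.Iio (0 : ℝ), (c {ω | x < X ω} - 1)) + ∫ x in Set.Ioi (0 : ℝ), c {ω | x < X ω}

/-- The Choquet integral of a bounded `ℕ`-valued function is the sum of the values of the set
function on the upper level sets. -/
theorem choquet_natCast {Ω : Type*} [MeasurableSpace Ω] (c : Set Ω → ℝ)
    (hc_empty : c ∅ = 0) (hc_univ : c Set.univ = 1) (z : Ω → ℕ) (N : ℕ) (hz : ∀ ω, z ω ≤ N) :
    choquet c (fun ω => (z ω : ℝ)) = ∑ k ∈ Finset.range N, c {ω | k < z ω} := by
  have hneg : ∫ x in Set.Iio (0 : ℝ), (c {ω | x < (z ω : ℝ)} - 1) = 0 := by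
    refine setIntegral_eq_zero_of_forall_eq_zero fun x hx => ?_
    have : {ω | x < (z ω : ℝ)} = Set.univ :=
      Set.eq_univ_of_forall fun ω => Set.mem_ofPred.2 (lt_of_lt_of_le hx (Nat.cast_nonneg _))
    rw [this, hc_univ, sub_self]
  have hcell : ∀ k : ℕ, Set.EqOn (fun x : ℝ => c {ω | x < (z ω : ℝ)})
      (fun _ => c {ω | k < z ω}) (Set.Ioo (k : ℝ) ((k + 1 : ℕ) : ℝ)) := by
    intro k x hx
    have : {ω | x < (z ω : ℝ)} = {ω | k < z ω} := by
      ext ω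
      refine ⟨fun h => Nat.cast_lt (α := ℝ).1 (hx.1.trans h), fun h => ?_⟩
      exact hx.2.trans_le (Nat.cast_le.2 (Nat.succ_le_of_lt h))
    simp only [this]
  have hle : ∀ k : ℕ, (k : ℝ) ≤ ((k + 1 : ℕ) : ℝ) := fun k => Nat.cast_le.2 k.le_succ
  have hint : ∀ k < N, IntervalIntegrable (fun x : ℝ => c {ω | x < (z ω : ℝ)}) volume
      (k : ℝ) ((k + 1 : ℕ) : ℝ) := by
    intro k _
    rw [intervalIntegrable_iff_integrableOn_Ioo_of_le (hle k),
      integrableOn_congr_fun (hcell k) measurableSet_Ioo]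
    exact integrableOn_const (by simp)
  have hpos : ∫ x in Set.Ioi (0 : ℝ), c {ω | x < (z ω : ℝ)} =
      ∫ x in (0 : ℝ)..N, c {ω | x < (z ω : ℝ)} := by
    rw [intervalIntegral.integral_of_le (Nat.cast_nonneg N)]
    refine setIntegral_eq_of_subset_of_forall_sdiff_eq_zero measurableSet_Ioi
      Set.Ioc_subset_Ioi_self fun x hx => ?_
    have : {ω | x < (z ω : ℝ)} = ∅ := by
      refine Set.eq_empty_of_forall_notMem fun ω h => hx.2 ⟨hx.1, ?_⟩
      exact (le_of_lt h).trans (Nat.cast_le.2 (hz ω))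
    rw [this, hc_empty]
  have hsum := intervalIntegral.sum_integral_adjacent_intervals (a := fun k : ℕ => (k : ℝ)) hint
  rw [Nat.cast_zero] at hsum
  rw [choquet, hneg, zero_add, hpos, ← hsum]
  refine Finset.sum_congr rfl fun k _ => ?_
  rw [intervalIntegral.integral_of_le (hle k), integral_Ioc_eq_integral_Ioo,
    setIntegral_congr_fun measurableSet_Ioo (hcell k)]
  simp

theorem Finset.sum_range_two_mul_eq_sum_add {M : Type*} [AddCommMonoid M] (f : ℕ → M) (N : ℕ) :
    ∑ k ∈ Finset.range (2 * N), f k = ∑ k ∈ Finset.range N, (f (2 * k) + f (2 * k + 1)) := by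
  induction N with
  | zero => simp
  | succ n ih =>
    rw [Finset.sum_range_succ, ← ih, mul_add_one, Finset.sum_range_succ, Finset.sum_range_succ,
      add_assoc]

/-- Subadditivity of the Choquet integral for bounded `ℕ`-valued functions that differ by at most
one. -/
theorem choquet_add_le_of_near {Ω : Type*} [MeasurableSpace Ω] (c : Set Ω → ℝ)
    (hc_empty : c ∅ = 0) (hc_univ : c Set.univ = 1)
    (hc_submod : ∀ A B : Set Ω, MeasurableSet A → MeasurableSet B →
        c (A ∪ B) + c (A ∩ B) ≤ c A + c B)
    (u v : Ω → ℕ) (hu : Measurable u) (hv : Measurable v) (N : ℕ)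
    (huN : ∀ ω, u ω ≤ N) (hvN : ∀ ω, v ω ≤ N)
    (huv : ∀ ω, u ω ≤ v ω + 1) (hvu : ∀ ω, v ω ≤ u ω + 1) :
    choquet c (fun ω => ((u ω + v ω : ℕ) : ℝ)) ≤
      choquet c (fun ω => (u ω : ℝ)) + choquet c (fun ω => (v ω : ℝ)) := by
  rw [choquet_natCast c hc_empty hc_univ u N huN, choquet_natCast c hc_empty hc_univ v N hvN,
    choquet_natCast c hc_empty hc_univ (fun ω => u ω + v ω) (2 * N)
      (fun ω => by have := huN ω; have := hvN ω; omega),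
    Finset.sum_range_two_mul_eq_sum_add, ← Finset.sum_add_distrib]
  refine Finset.sum_le_sum fun k _ => ?_
  have hunion : {ω | 2 * k < u ω + v ω} = {ω | k < u ω} ∪ {ω | k < v ω} := by
    ext ω
    have := huv ω
    have := hvu ω
    simp only [Set.mem_ofPred_eq, Set.mem_union]
    omega
  have hinter : {ω | 2 * k + 1 < u ω + v ω} = {ω | k < u ω} ∩ {ω | k < v ω} := by
    ext ω
    have := huv ω
    have := hvu ω
    simp only [Set.mem_ofPred_eq, Set.mem_inter_iff]
    omega
  rw [hunion, hinter]
  exact hc_submod _ _ (measurableSet_lt measurable_const hu) (measurableSet_lt measurable_const hv)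

theorem exists_measurable_nat_bounded {Ω : Type*} [MeasurableSpace Ω] {X : Ω → ℝ}
    (hX : Measurable X) (hXb : ∃ M, ∀ ω, |X ω| ≤ M) (hXnat : ∀ ω, ∃ n : ℕ, X ω = n) :
    ∃ x : Ω → ℕ, Measurable x ∧ (∃ N, ∀ ω, x ω ≤ N) ∧ X = fun ω => (x ω : ℝ) := by
  obtain ⟨M, hM⟩ := hXb
  refine ⟨fun ω => ⌊X ω⌋₊, Nat.measurable_floor.comp hX, ⟨⌊M⌋₊, fun ω => ?_⟩, ?_⟩
  · exact Nat.floor_le_floor ((le_abs_self _).trans (hM ω))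
  · funext ω
    obtain ⟨n, hn⟩ := hXnat ω
    simp [hn]

theorem floor_natCast_div_two (n : ℕ) : (⌊(n : ℝ) / 2⌋ : ℝ) = ((n / 2 : ℕ) : ℝ) := by
  have h : ⌊(n : ℝ) / 2⌋ = ((n / 2 : ℕ) : ℤ) := by
    simpa using Int.floor_div_natCast (n : ℝ) 2
  rw [h, Int.cast_natCast]

/-- The key intermediate inequality: for `c` submodular and `X, Y` bounded measurable
with values in `ℕ`,
`∫(X+Y) dc ≤ ∫(⌊X/2⌋ + ⌊(Y+1)/2⌋) dc + ∫(⌊(X+1)/2⌋ + ⌊Y/2⌋) dc`. -/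
theorem choquet_add_le_floor_halves {Ω : Type*} [MeasurableSpace Ω] (c : Set Ω → ℝ)
    (hc_mono : ∀ ⦃A B : Set Ω⦄, MeasurableSet A → MeasurableSet B → A ⊆ B → c A ≤ c B)
    (hc_range : ∀ A : Set Ω, MeasurableSet A → c A ∈ Set.Icc (0 : ℝ) 1)
    (hc_empty : c ∅ = 0) (hc_univ : c Set.univ = 1)
    (hc_submod : ∀ A B : Set Ω, MeasurableSet A → MeasurableSet B →
        c (A ∪ B) + c (A ∩ B) ≤ c A + c B)
    (X Y : Ω → ℝ) (hX : Measurable X) (hY : Measurable Y)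
    (hXb : ∃ M, ∀ ω, |X ω| ≤ M) (hYb : ∃ M, ∀ ω, |Y ω| ≤ M)
    (hXnat : ∀ ω, ∃ n : ℕ, X ω = n) (hYnat : ∀ ω, ∃ n : ℕ, Y ω = n) :
    choquet c (fun ω => X ω + Y ω) ≤
      choquet c (fun ω => (⌊X ω / 2⌋ : ℝ) + (⌊(Y ω + 1) / 2⌋ : ℝ)) +
        choquet c (fun ω => (⌊(X ω + 1) / 2⌋ : ℝ) + (⌊Y ω / 2⌋ : ℝ)) := by
  obtain ⟨x, hx, ⟨N, hxN⟩, rfl⟩ := exists_measurable_nat_bounded hX hXb hXnat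
  obtain ⟨y, hy, ⟨K, hyK⟩, rfl⟩ := exists_measurable_nat_bounded hY hYb hYnat
  have hfloor : ∀ n : ℕ, (⌊((n : ℝ) + 1) / 2⌋ : ℝ) = (((n + 1) / 2 : ℕ) : ℝ) := fun n => by
    rw [← floor_natCast_div_two, Nat.cast_add_one]
  simp only [floor_natCast_div_two, hfloor, ← Nat.cast_add]
  have hsplit : ∀ ω, x ω + y ω =
      (x ω / 2 + (y ω + 1) / 2) + ((x ω + 1) / 2 + y ω / 2) := fun ω => by omega
  simp only [hsplit]
  refine choquet_add_le_of_near c hc_empty hc_univ hc_submod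
    (fun ω => x ω / 2 + (y ω + 1) / 2) (fun ω => (x ω + 1) / 2 + y ω / 2)
    (by fun_prop) (by fun_prop) (N + K) ?_ ?_ ?_ ?_ <;>
  · intro ω
    have := hxN ω
    have := hyK ω
    omega
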